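/- Let Δ ≥ 1, 0 ≤ x ≤ Δ and 1 ≤ y ≤ Δ be integers, and let G be a simple graph whose vertex set is partitioned into a white side and a black side, such that every edge joins a white vertex to a black vertex and every vertex has degree exactly Δ. Suppose ℓ is a labeling of the edges of G with labels from {M,P,O,X} such that for every white vertex the multiset of labels of its Δ incident edges is a white configuration of Φ_Δ(x,y), and for every black vertex the multiset of labels of its Δ incident edges is a black configuration of Φ_Δ(x,y). Then the set M* of edges labeled M is an x-maximal y-matching of G: every vertex is incident to at most y edges of M*, and every vertex incident to no edge of M* has at least Δ-x neighbors that are incident to at least one edge of M*. -/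

import Mathlib

/-- The four-element alphabet {M, P, O, X}. -/
inductive Label4 where
  | M | P | O | X
deriving DecidableEq

open Label4

/-- Black configurations of Φ_Δ(x,y). -/
def blackPhi (Δ x y : ℕ) (w : Multiset Label4) : Prop :=
  (∃ s u, w = s + (M ::ₘ u) ∧ Multiset.card s = y - 1 ∧
    Multiset.card u = Δ - y ∧ ∀ l ∈ u, l ∈ ({P, O, X} : Finset Label4)) ∨
  (∃ s, w = s + Multiset.replicate (Δ - x) O ∧ Multiset.card s = x ∧
    ∀ l ∈ s, l ∈ ({O, X} : Finset Label4))

/-- White configurations of Φ_Δ(x,y). -/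
def whitePhi (Δ x y : ℕ) (w : Multiset Label4) : Prop :=
  (∃ s u, w = s + (M ::ₘ u) ∧ Multiset.card s = y - 1 ∧
    (∀ l ∈ s, l ∈ ({M, O, X} : Finset Label4)) ∧
    Multiset.card u = Δ - y ∧ ∀ l ∈ u, l ∈ ({O, X} : Finset Label4)) ∨
  (∃ s, w = s + Multiset.replicate (Δ - x) P ∧ Multiset.card s = x ∧
    ∀ l ∈ s, l ∈ ({P, X} : Finset Label4))

theorem card_filter_label {α : Type*} (s : Finset α) (f : α → Label4) (c : Label4) :
    (s.filter (fun e => f e = c)).card = (s.val.map f).count c := by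
  rw [Multiset.count_map, Finset.card_def, Finset.filter_val]
  simp only [eq_comm]

theorem count_M_of_two_parts {y : ℕ} (hy : 1 ≤ y) {s u : Multiset Label4}
    (hs : Multiset.card s = y - 1) (hu : M ∉ u) :
    (s + (M ::ₘ u)).count M ≤ y := by
  have := Multiset.count_le_card M s
  rw [Multiset.count_add, Multiset.count_cons_self, Multiset.count_eq_zero_of_notMem hu]
  omega

theorem blackPhi.count_M_le {Δ x y : ℕ} (hy : 1 ≤ y) {w : Multiset Label4}
    (h : blackPhi Δ x y w) : w.count M ≤ y := by
  rcases h with ⟨s, u, rfl, hs, -, hu⟩ | ⟨s, rfl, -, hs⟩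
  · exact count_M_of_two_parts hy hs fun hM => by simpa using hu M hM
  · rw [Multiset.count_eq_zero_of_notMem]
    · exact Nat.zero_le y
    · intro hM
      rcases Multiset.mem_add.1 hM with hM | hM
      · simpa using hs M hM
      · simpa using Multiset.eq_of_mem_replicate hM

theorem whitePhi.count_M_le {Δ x y : ℕ} (hy : 1 ≤ y) {w : Multiset Label4}
    (h : whitePhi Δ x y w) : w.count M ≤ y := by
  rcases h with ⟨s, u, rfl, hs, -, -, hu⟩ | ⟨s, rfl, -, hs⟩
  · exact count_M_of_two_parts hy hs fun hM => by simpa using hu M hM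
  · rw [Multiset.count_eq_zero_of_notMem]
    · exact Nat.zero_le y
    · intro hM
      rcases Multiset.mem_add.1 hM with hM | hM
      · simpa using hs M hM
      · simpa using Multiset.eq_of_mem_replicate hM

theorem blackPhi.le_count_O {Δ x y : ℕ} {w : Multiset Label4}
    (h : blackPhi Δ x y w) (hM : M ∉ w) : Δ - x ≤ w.count O := by
  rcases h with ⟨s, u, rfl, -⟩ | ⟨s, rfl, -⟩
  · simp at hM
  · simp

theorem whitePhi.le_count_P {Δ x y : ℕ} {w : Multiset Label4}
    (h : whitePhi Δ x y w) (hM : M ∉ w) : Δ - x ≤ w.count P := by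
  rcases h with ⟨s, u, rfl, -⟩ | ⟨s, rfl, -⟩
  · simp at hM
  · simp

theorem blackPhi.M_mem_of_P_mem {Δ x y : ℕ} {w : Multiset Label4}
    (h : blackPhi Δ x y w) (hP : P ∈ w) : M ∈ w := by
  rcases h with ⟨s, u, rfl, -⟩ | ⟨s, rfl, -, hs⟩
  · simp
  · rcases Multiset.mem_add.1 hP with hP | hP
    · simpa using hs P hP
    · simpa using Multiset.eq_of_mem_replicate hP

theorem whitePhi.M_mem_of_O_mem {Δ x y : ℕ} {w : Multiset Label4}
    (h : whitePhi Δ x y w) (hO : O ∈ w) : M ∈ w := by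
  rcases h with ⟨s, u, rfl, -⟩ | ⟨s, rfl, -, hs⟩
  · simp
  · rcases Multiset.mem_add.1 hO with hO | hO
    · simpa using hs O hO
    · simpa using Multiset.eq_of_mem_replicate hO

/-- If every edge labelled `c` at `v` leads to a vertex incident to an edge labelled `M`, then `v`
has at least as many such neighbours as it has edges labelled `c`. -/
theorem count_label_le_card_matched_neighbors {V : Type*} [Fintype V] [DecidableEq V]
    (G : SimpleGraph V) [DecidableRel G.Adj] (ℓ : Sym2 V → Label4) (c : Label4) (v : V)
    (h : ∀ u, G.Adj v u → c ∈ (G.incidenceFinset u).val.map ℓ →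
      M ∈ (G.incidenceFinset u).val.map ℓ) :
    ((G.incidenceFinset v).val.map ℓ).count c ≤ ((G.neighborFinset v).filter
        (fun u => ∃ e ∈ G.incidenceFinset u, ℓ e = M)).card := by
  rw [← card_filter_label]
  refine (Finset.card_le_card fun e he => ?_).trans
    (Finset.card_image_le (f := fun u => s(v, u)))
  obtain ⟨he, hc⟩ := Finset.mem_filter.1 he
  rw [SimpleGraph.mem_incidenceFinset] at he
  obtain ⟨u, rfl⟩ := Sym2.mem_iff_exists.1 he.2
  have hadj : G.Adj v u := he.1
  refine Finset.mem_image.2 ⟨u, Finset.mem_filter.2 ⟨by simpa using hadj, ?_⟩, rfl⟩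
  have hu : s(v, u) ∈ G.incidenceFinset u :=
    (G.mem_incidenceFinset u _).2 ⟨he.1, Sym2.mem_mk_right v u⟩
  exact Multiset.mem_map.1 (h u hadj (Multiset.mem_map.2 ⟨_, hu, hc⟩))

theorem stmt13 (Δ x y : ℕ) (hΔ : 1 ≤ Δ) (hx : x ≤ Δ) (hy1 : 1 ≤ y) (hy2 : y ≤ Δ)
    {V : Type*} [Fintype V] [DecidableEq V]
    (G : SimpleGraph V) [DecidableRel G.Adj]
    (white : V → Bool)
    (hbip : ∀ u v : V, G.Adj u v → white u ≠ white v)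
    (hreg : ∀ v : V, G.degree v = Δ)
    (ℓ : Sym2 V → Label4)
    (hwhite : ∀ v : V, white v = true →
      whitePhi Δ x y ((G.incidenceFinset v).val.map ℓ))
    (hblack : ∀ v : V, white v = false →
      blackPhi Δ x y ((G.incidenceFinset v).val.map ℓ)) :
    (∀ v : V, ((G.incidenceFinset v).filter (fun e => ℓ e = M)).card ≤ y) ∧
    (∀ v : V, (∀ e ∈ G.incidenceFinset v, ℓ e ≠ M) →
      Δ - x ≤ ((G.neighborFinset v).filter
        (fun u => ∃ e ∈ G.incidenceFinset u, ℓ e = M)).card) := by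
  refine ⟨fun v => ?_, fun v hv => ?_⟩
  · rw [card_filter_label]
    cases hc : white v with
    | true => exact (hwhite v hc).count_M_le hy1
    | false => exact (hblack v hc).count_M_le hy1
  · have hM : M ∉ (G.incidenceFinset v).val.map ℓ := fun hM => by
      obtain ⟨e, he, heM⟩ := Multiset.mem_map.1 hM
      exact hv e he heM
    cases hc : white v with
    | true =>
      refine ((hwhite v hc).le_count_P hM).trans
        (count_label_le_card_matched_neighbors G ℓ P v fun u hu => ?_)
      exact (hblack u (by have := hbip v u hu; simpa [hc] using this)).M_mem_of_P_mem
    | false =>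
      refine ((hblack v hc).le_count_O hM).trans
        (count_label_le_card_matched_neighbors G ℓ O v fun u hu => ?_)
      exact (hwhite u (by have := hbip v u hu; simpa [hc] using this)).M_mem_of_O_mem
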